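/- If two pointed relational models (M1,w1) and (M2,w2) are generalized point sabotage bisimilar (r-bisimilar), then they satisfy exactly the same formulas of the modal logic of stepwise removal MLSR: for every MLSR formula φ, (M1,w1) ⊨ φ if and only if (M2,w2) ⊨ φ. -/

import Mathlib

/-- A relational model with an explicit set of worlds `dom`, a relation and a
valuation of propositional letters `P`. -/
structure PModel (α P : Type*) where
  dom : Set α
  rel : Set (α × α)
  val : P → Set α

variable {α β P : Type*}

/-- `M ∖ {v}`: the model obtained from `M` by deleting the world `v`,
removing all edges incident with `v` and removing `v` from the valuation. -/
def PModel.delPoint (M : PModel α P) (v : α) : PModel α P :=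
  ⟨M.dom \ {v}, {e ∈ M.rel | e.1 ≠ v ∧ e.2 ≠ v}, fun p => M.val p \ {v}⟩

/-- Formulas of the modal logic of stepwise removal (MLSR):
`φ ::= p | ¬φ | φ∧φ | ◇φ | ⟨−ψ⟩φ`. -/
inductive RForm (P : Type*) where
  | atom : P → RForm P
  | neg : RForm P → RForm P
  | and : RForm P → RForm P → RForm P
  | dia : RForm P → RForm P
  | rem : RForm P → RForm P → RForm P

/-- Truth of an MLSR formula at a pointed model.  In particular
`(M,w) ⊨ ⟨−ψ⟩φ` iff there is a world `v ≠ w` with `(M,v) ⊨ ψ` and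
`(M∖{v}, w) ⊨ φ`. -/
def PModel.Sat : PModel α P → α → RForm P → Prop
  | M, w, .atom p => w ∈ M.val p
  | M, w, .neg φ => ¬ M.Sat w φ
  | M, w, .and φ ψ => M.Sat w φ ∧ M.Sat w ψ
  | M, w, .dia φ => ∃ v, (w, v) ∈ M.rel ∧ M.Sat v φ
  | M, w, .rem ψ φ => ∃ v ∈ M.dom, v ≠ w ∧ M.Sat v ψ ∧ (M.delPoint v).Sat w φ

/-- `Z` is a generalized point sabotage bisimulation between pointed models. -/
def IsRBisim (Z : PModel α P → α → PModel β P → β → Prop) : Prop :=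
  ∀ M1 w1 M2 w2, Z M1 w1 M2 w2 →
    (∀ p, w1 ∈ M1.val p ↔ w2 ∈ M2.val p) ∧
    (∀ v1, (w1, v1) ∈ M1.rel → ∃ v2, (w2, v2) ∈ M2.rel ∧ Z M1 v1 M2 v2) ∧
    (∀ v2, (w2, v2) ∈ M2.rel → ∃ v1, (w1, v1) ∈ M1.rel ∧ Z M1 v1 M2 v2) ∧
    (∀ u1 ∈ M1.dom, u1 ≠ w1 → ∃ u2 ∈ M2.dom, u2 ≠ w2 ∧
      Z M1 u1 M2 u2 ∧ Z (M1.delPoint u1) w1 (M2.delPoint u2) w2) ∧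
    (∀ u2 ∈ M2.dom, u2 ≠ w2 → ∃ u1 ∈ M1.dom, u1 ≠ w1 ∧
      Z M1 u1 M2 u2 ∧ Z (M1.delPoint u1) w1 (M2.delPoint u2) w2)

/-- Two pointed models are generalized point sabotage bisimilar (r-bisimilar,
or MLSR bisimilar). -/
def RBisimilar (M1 : PModel α P) (w1 : α) (M2 : PModel β P) (w2 : β) : Prop :=
  ∃ Z, IsRBisim Z ∧ Z M1 w1 M2 w2

/-- Pointed models related by a generalized point sabotage bisimulation satisfy
the same formulas. -/
theorem IsRBisim.sat_iff {Z : PModel α P → α → PModel β P → β → Prop} (hZ : IsRBisim Z)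
    (φ : RForm P) {M1 : PModel α P} {w1 : α} {M2 : PModel β P} {w2 : β}
    (h : Z M1 w1 M2 w2) : M1.Sat w1 φ ↔ M2.Sat w2 φ := by
  induction φ generalizing M1 w1 M2 w2 with
  | atom p => simpa only [PModel.Sat] using (hZ _ _ _ _ h).1 p
  | neg φ ih => simpa only [PModel.Sat] using not_congr (ih h)
  | and φ ψ ihφ ihψ => simpa only [PModel.Sat] using and_congr (ihφ h) (ihψ h)
  | dia φ ih =>
    obtain ⟨-, zig, zag, -, -⟩ := hZ _ _ _ _ h
    simp only [PModel.Sat]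
    constructor
    · rintro ⟨v1, hr, hs⟩
      obtain ⟨v2, hr2, hv⟩ := zig v1 hr
      exact ⟨v2, hr2, (ih hv).1 hs⟩
    · rintro ⟨v2, hr, hs⟩
      obtain ⟨v1, hr1, hv⟩ := zag v2 hr
      exact ⟨v1, hr1, (ih hv).2 hs⟩
  | rem ψ φ ihψ ihφ =>
    obtain ⟨-, -, -, zig, zag⟩ := hZ _ _ _ _ h
    simp only [PModel.Sat]
    constructor
    · rintro ⟨u1, hd, hne, hψ, hφ⟩
      obtain ⟨u2, hd2, hne2, hu, hdel⟩ := zig u1 hd hne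
      exact ⟨u2, hd2, hne2, (ihψ hu).1 hψ, (ihφ hdel).1 hφ⟩
    · rintro ⟨u2, hd, hne, hψ, hφ⟩
      obtain ⟨u1, hd1, hne1, hu, hdel⟩ := zag u2 hd hne
      exact ⟨u1, hd1, hne1, (ihψ hu).2 hψ, (ihφ hdel).2 hφ⟩

/-- If two pointed models are generalized point sabotage bisimilar, then they
satisfy the same MLSR formulas. -/
theorem rbisimilar_iff_sat (M1 : PModel α P) (w1 : α) (M2 : PModel β P) (w2 : β)
    (h : RBisimilar M1 w1 M2 w2) :
    ∀ φ : RForm P, M1.Sat w1 φ ↔ M2.Sat w2 φ := by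
  obtain ⟨Z, hZ, hw⟩ := h
  exact fun φ => hZ.sat_iff φ hw
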